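/- arXiv:2303.12377 — 9 statements merged into one kernel-verified Lean document; each statement's English description precedes it below -/
import Mathlib

section
/- For every natural number m ≥ 1 and all real numbers u and ω, U_m(u, ω) = 4·cos²(mω/2)·sin²((m−2)ω/2) + (mu − 2·cos(mω/2)·cos((2−m)ω/2))². -/
open Real

/-- `U_m(u, ω) = 2 + m²u² − 2mu(cos ω + cos((m−1)ω)) + 2cos(mω)`, the factor in the
spectral density of the type 1 HARMA process. -/
noncomputable def U (m : ℕ) (u ω : ℝ) : ℝ :=
  2 + (m : ℝ) ^ 2 * u ^ 2 - 2 * m * u * (Real.cos ω + Real.cos (((m : ℝ) - 1) * ω))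
    + 2 * Real.cos (m * ω)

/-- Decomposition of `U_m(u, ω)` used to locate singular points of the spectral density. -/
theorem U_eq_decomposition (m : ℕ) (hm : 1 ≤ m) (u ω : ℝ) :
    U m u ω =
      4 * Real.cos ((m : ℝ) * ω / 2) ^ 2 * Real.sin (((m : ℝ) - 2) * ω / 2) ^ 2 +
        ((m : ℝ) * u - 2 * Real.cos ((m : ℝ) * ω / 2) * Real.cos ((2 - (m : ℝ)) * ω / 2)) ^ 2 := by
  have hsum : Real.cos ω + Real.cos (((m : ℝ) - 1) * ω) =
      2 * Real.cos ((m : ℝ) * ω / 2) * Real.cos ((2 - (m : ℝ)) * ω / 2) := by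
    rw [Real.cos_add_cos]
    ring_nf
  have hdouble : Real.cos ((m : ℝ) * ω) = 2 * Real.cos ((m : ℝ) * ω / 2) ^ 2 - 1 := by
    rw [← Real.cos_two_mul]
    ring_nf
  have hsin : Real.sin (((m : ℝ) - 2) * ω / 2) ^ 2 =
      1 - Real.cos ((2 - (m : ℝ)) * ω / 2) ^ 2 := by
    rw [Real.sin_sq, ← Real.cos_neg]
    ring_nf
  rw [U, hsum, hdouble, hsin]
  ring
end

section
/- For every natural number m ≥ 1 and all real numbers u and ω, U_m(u, ω) ≥ 0. -/
open Real

/-- `U_m(u, ω)` is nonnegative. -/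
theorem U_nonneg (m : ℕ) (hm : 1 ≤ m) (u ω : ℝ) : 0 ≤ U m u ω := by
  have hω : ω = m * ω / 2 - (m - 2) * ω / 2 := by ring
  have hm1 : ((m : ℝ) - 1) * ω = m * ω / 2 + (m - 2) * ω / 2 := by ring
  have hm0 : (m : ℝ) * ω = 2 * (m * ω / 2) := by ring
  have hsum : Real.cos ω + Real.cos (((m : ℝ) - 1) * ω)
      = 2 * Real.cos (m * ω / 2) * Real.cos ((m - 2) * ω / 2) := by
    rw [hm1, Real.cos_add]
    nth_rewrite 1 [hω]
    rw [Real.cos_sub]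
    ring
  have hdouble : Real.cos (m * ω) = 2 * Real.cos (m * ω / 2) ^ 2 - 1 := by
    rw [← Real.cos_two_mul, ← hm0]
  rw [U, hsum, hdouble]
  generalize Real.cos (m * ω / 2) = a
  have hb := Real.sin_sq_add_cos_sq ((m - 2) * ω / 2)
  generalize Real.cos ((m - 2) * ω / 2) = b at hb ⊢
  generalize Real.sin ((m - 2) * ω / 2) = s at hb
  have key : 2 + (m : ℝ) ^ 2 * u ^ 2 - 2 * m * u * (2 * a * b) + 2 * (2 * a ^ 2 - 1)
      = (m * u - 2 * a * b) ^ 2 + (2 * a * s) ^ 2 := by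
    linear_combination -4 * a ^ 2 * hb
  rw [key]
  positivity
end

section
/- For every natural number m with m ≥ 1 and m ≠ 2 and every integer n, setting ω₀ = 2nπ/(m−2) and u₀ = (2/m)·cos(2nπ/(m−2)), one has U_m(u₀, ω₀) = 0. -/
open Real

/-- For `m ≠ 2`, setting `ω₀ = 2nπ/(m−2)` and `u₀ = (2/m)cos(2nπ/(m−2))`,
one has `U_m(u₀, ω₀) = 0`. -/
theorem U_vanishes_at_singular_point (m : ℕ) (hm : 1 ≤ m) (hm2 : m ≠ 2) (n : ℤ) :
    U m ((2 / (m : ℝ)) * Real.cos (2 * (n : ℝ) * Real.pi / ((m : ℝ) - 2)))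
      (2 * (n : ℝ) * Real.pi / ((m : ℝ) - 2)) = 0 := by
  have hm0 : (m : ℝ) ≠ 0 := by positivity
  have hm2' : (m : ℝ) - 2 ≠ 0 := sub_ne_zero.mpr (mod_cast hm2)
  have hω : ((m : ℝ) - 2) * (2 * (n : ℝ) * Real.pi / ((m : ℝ) - 2)) = n * (2 * Real.pi) := by
    field_simp
  generalize 2 * (n : ℝ) * Real.pi / ((m : ℝ) - 2) = ω at hω ⊢
  have hcos₁ : Real.cos (((m : ℝ) - 1) * ω) = Real.cos ω := by
    rw [show ((m : ℝ) - 1) * ω = ω + n * (2 * Real.pi) by linear_combination hω,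
      Real.cos_add_int_mul_two_pi]
  have hcos₂ : Real.cos (m * ω) = 2 * Real.cos ω ^ 2 - 1 := by
    rw [show (m : ℝ) * ω = 2 * ω + n * (2 * Real.pi) by linear_combination hω,
      Real.cos_add_int_mul_two_pi, Real.cos_two_mul]
  rw [U, hcos₁, hcos₂]
  field_simp
  ring
end

section
/- Let m ≥ 1 be a natural number and let ν be a real number with |ν| < 1/2 and ν ≠ 0, and let u be a real number with 0 ≤ u ≤ 2/m. Then the series ∑_{n=0}^{∞} (Γ(ν+n)/(Γ(ν)·Γ(n+1)))² · (mu − 1)^{2n} converges. -/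
open Real

/-- Nonnegative terms dominated by the decrements of a nonnegative sequence are summable. -/
theorem summable_of_add_le_of_nonneg {f g : ℕ → ℝ} (hf : ∀ n, 0 ≤ f n) (hg : ∀ n, 0 ≤ g n)
    (h : ∀ n, g (n + 1) + f n ≤ g n) : Summable f := by
  have key : ∀ n, ∑ i ∈ Finset.range n, f i + g n ≤ g 0 := by
    intro n
    induction n with
    | zero => simp
    | succ k ih =>
      rw [Finset.sum_range_succ]
      linarith [h k]
  exact summable_of_sum_range_le hf fun n => by linarith [key n, hg n]

/-- The squared binomial coefficients `Γ(ν+n)/(Γ(ν)Γ(n+1))` are summable when `ν < 1/2`. -/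
theorem summable_sq_Gamma_ratio {ν : ℝ} (hν : ν < 1 / 2) :
    Summable fun n : ℕ =>
      (Real.Gamma (ν + n) / (Real.Gamma ν * Real.Gamma ((n : ℝ) + 1))) ^ 2 := by
  set a : ℕ → ℝ := fun n =>
    (Real.Gamma (ν + n) / (Real.Gamma ν * Real.Gamma ((n : ℝ) + 1))) ^ 2 with ha
  have a_nonneg : ∀ n, 0 ≤ a n := fun n => sq_nonneg _
  have a_succ : ∀ n : ℕ, ν + n ≠ 0 → a (n + 1) = a n * ((ν + n) / (n + 1)) ^ 2 := by
    intro n hn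
    have h1 : (n : ℝ) + 1 ≠ 0 := by positivity
    simp only [ha]
    push_cast
    rw [← add_assoc, Real.Gamma_add_one hn, Real.Gamma_add_one h1, ← mul_pow,
      div_mul_div_comm]
    ring
  set δ : ℝ := (1 - 2 * ν) / 2 with hδ
  have δ_pos : 0 < δ := by rw [hδ]; linarith
  obtain ⟨N, hN⟩ := exists_nat_gt (max ((ν ^ 2 + δ) / δ) (-ν))
  rw [← summable_nat_add_iff N, ← summable_mul_left_iff δ_pos.ne']
  refine summable_of_add_le_of_nonneg (g := fun n => ((n + N : ℕ) : ℝ) * a (n + N))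
    (fun n => mul_nonneg δ_pos.le (a_nonneg _))
    (fun n => mul_nonneg (Nat.cast_nonneg _) (a_nonneg _)) fun n => ?_
  have hk : (N : ℝ) ≤ ((n + N : ℕ) : ℝ) := by exact_mod_cast Nat.le_add_left N n
  rw [show n + 1 + N = n + N + 1 by ring]
  generalize n + N = k at hk
  have h1 : (ν ^ 2 + δ) / δ < k := ((le_max_left _ _).trans_lt hN).trans_le hk
  have h2 : -ν < k := ((le_max_right _ _).trans_lt hN).trans_le hk
  rw [div_lt_iff₀ δ_pos] at h1
  have hk1 : (0 : ℝ) < k + 1 := by positivity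
  rw [a_succ k (by linarith)]
  have h3 : ((k + 1 : ℕ) : ℝ) * ((ν + k) / (k + 1)) ^ 2 + δ ≤ k := by
    have : ((k + 1 : ℕ) : ℝ) * ((ν + k) / (k + 1)) ^ 2 = (ν + k) ^ 2 / (k + 1) := by
      push_cast
      field_simp
    rw [this, ← le_sub_iff_add_le, div_le_iff₀ hk1]
    nlinarith
  nlinarith [mul_le_mul_of_nonneg_right h3 (a_nonneg k)]

/-- For `|ν| < 1/2`, `ν ≠ 0`, `0 ≤ u ≤ 2/m`, the series
`∑ (Γ(ν+n)/(Γ(ν)Γ(n+1)))² (mu − 1)^{2n}` (equal to `Var(X_t)/σ²` for the type 1 HARMA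
process) converges. -/
theorem harma_variance_summable (m : ℕ) (hm : 1 ≤ m) (ν : ℝ) (hν : |ν| < 1 / 2)
    (hν0 : ν ≠ 0) (u : ℝ) (hu0 : 0 ≤ u) (hu1 : u ≤ 2 / m) :
    Summable fun n : ℕ =>
      (Real.Gamma (ν + n) / (Real.Gamma ν * Real.Gamma ((n : ℝ) + 1))) ^ 2 *
        ((m : ℝ) * u - 1) ^ (2 * n) := by
  have hm0 : (0 : ℝ) < m := by exact_mod_cast hm
  rw [le_div_iff₀ hm0] at hu1
  have hmu : 0 ≤ (m : ℝ) * u := by positivity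
  have hsq : ((m : ℝ) * u - 1) ^ 2 ≤ 1 := by
    rw [sq_le_one_iff_abs_le_one, abs_le]
    constructor <;> linarith
  refine (summable_sq_Gamma_ratio (abs_lt.mp hν).2).of_nonneg_of_le (fun n => ?_) fun n => ?_
  · rw [pow_mul]
    positivity
  · rw [pow_mul]
    exact mul_le_of_le_one_right (sq_nonneg _) (pow_le_one₀ (sq_nonneg _) hsq)
end

section
/- For every natural number m ≥ 1 and all real numbers u and ω, V_m(u, ω) = 4·cos²(mω/2)·sin²((m−2)ω/2) + (2u − 2·cos(mω/2)·cos((2−m)ω/2))². -/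
open Real

/-- `V_m(u, ω) = 2 + 4u² − 4u(cos ω + cos((m−1)ω)) + 2cos(mω)`, the factor in the
spectral density of the type 2 HARMA process. -/
noncomputable def V (m : ℕ) (u ω : ℝ) : ℝ :=
  2 + 4 * u ^ 2 - 4 * u * (Real.cos ω + Real.cos (((m : ℝ) - 1) * ω)) + 2 * Real.cos (m * ω)

/-- Decomposition of `V_m(u, ω)` used to locate singular points of the spectral density. -/
theorem V_eq_decomposition (m : ℕ) (hm : 1 ≤ m) (u ω : ℝ) :
    V m u ω =
      4 * Real.cos ((m : ℝ) * ω / 2) ^ 2 * Real.sin (((m : ℝ) - 2) * ω / 2) ^ 2 +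
        (2 * u - 2 * Real.cos ((m : ℝ) * ω / 2) * Real.cos ((2 - (m : ℝ)) * ω / 2)) ^ 2 := by
  have hω : ω = (m : ℝ) * ω / 2 - ((m : ℝ) - 2) * ω / 2 := by ring
  have hsum : ((m : ℝ) - 1) * ω = (m : ℝ) * ω / 2 + ((m : ℝ) - 2) * ω / 2 := by ring
  have hcos : Real.cos ω + Real.cos (((m : ℝ) - 1) * ω) =
      2 * Real.cos ((m : ℝ) * ω / 2) * Real.cos (((m : ℝ) - 2) * ω / 2) := by
    rw [congrArg Real.cos hω, hsum, Real.cos_sub, Real.cos_add]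
    ring
  have hdouble : Real.cos (m * ω) = 2 * Real.cos ((m : ℝ) * ω / 2) ^ 2 - 1 := by
    rw [← Real.cos_two_mul]
    ring_nf
  have hneg : Real.cos ((2 - (m : ℝ)) * ω / 2) = Real.cos (((m : ℝ) - 2) * ω / 2) := by
    rw [← Real.cos_neg]
    ring_nf
  rw [V, hcos, hdouble, hneg, Real.sin_sq]
  ring
end

section
/- For every natural number m with m ≥ 1 and m ≠ 2 and every integer n, setting ω₀ = 2nπ/(m−2) and u₀ = cos(2nπ/(m−2)), one has V_m(u₀, ω₀) = 0. -/
open Real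

/-- For `m ≠ 2`, setting `ω₀ = 2nπ/(m−2)` and `u₀ = cos(2nπ/(m−2))`,
one has `V_m(u₀, ω₀) = 0`. -/
theorem V_vanishes_at_singular_point (m : ℕ) (hm : 1 ≤ m) (hm2 : m ≠ 2) (n : ℤ) :
    V m (Real.cos (2 * (n : ℝ) * Real.pi / ((m : ℝ) - 2)))
      (2 * (n : ℝ) * Real.pi / ((m : ℝ) - 2)) = 0 := by
  have hm' : (m : ℝ) - 2 ≠ 0 := sub_ne_zero.mpr (by exact_mod_cast hm2)
  set ω : ℝ := 2 * (n : ℝ) * Real.pi / ((m : ℝ) - 2) with hω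
  have hmul : ((m : ℝ) - 2) * ω = n * (2 * Real.pi) := by
    rw [hω]
    field_simp
  have hpred : ((m : ℝ) - 1) * ω = ω + n * (2 * Real.pi) := by linarith
  have hself : (m : ℝ) * ω = 2 * ω + n * (2 * Real.pi) := by linarith
  rw [V, hpred, hself, Real.cos_add_int_mul_two_pi, Real.cos_add_int_mul_two_pi,
    Real.cos_two_mul]
  ring
end

section
/- Let m ≥ 1 be a natural number, k an integer, ω₀ = (2k+1)π/m, and let ν, δ be real numbers with 0 < ν < 1/2 and δ > 0. Then there exists η > 0 such that the function ω ↦ (ω − ω₀)^{δ+2ν}·(2 + 2cos(mω))^{−ν} is strictly monotone increasing on the interval (ω₀, ω₀ + η) (on which 2 + 2cos(mω) > 0). -/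
open Real Set

/-- `sin x / x` is decreasing on `(0, π]`, in cross-multiplied form. -/
lemma mul_sin_le_mul_sin {x y : ℝ} (hx : 0 < x) (hxy : x ≤ y) (hy : y ≤ π) :
    x * Real.sin y ≤ y * Real.sin x := by
  have hy0 : 0 < y := hx.trans_le hxy
  have h := strictConcaveOn_sin_Icc.concaveOn.2 (⟨le_rfl, Real.pi_pos.le⟩ : (0 : ℝ) ∈ Icc 0 π)
    (⟨hy0.le, hy⟩ : y ∈ Icc 0 π) (sub_nonneg.2 ((div_le_one hy0).2 hxy)) (by positivity)
    (sub_add_cancel 1 (x / y))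
  simp only [smul_eq_mul, Real.sin_zero, mul_zero, zero_add, div_mul_cancel₀ x hy0.ne'] at h
  calc x * Real.sin y = y * (x / y * Real.sin y) := by field_simp
    _ ≤ y * Real.sin x := by gcongr

/-- Near an odd multiple of `π / m`, `2 + 2 cos (m ω)` is a squared sine of the half-angle. -/
lemma two_add_two_cos_mul_eq {m : ℝ} (hm : m ≠ 0) (k : ℤ) (ω : ℝ) :
    2 + 2 * Real.cos (m * ω) =
      (2 * Real.sin (m * (ω - (2 * (k : ℝ) + 1) * π / m) / 2)) ^ 2 := by
  have h : m * ω =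
      2 * (m * (ω - (2 * (k : ℝ) + 1) * π / m) / 2) + π + k * (2 * π) := by
    field_simp
    ring
  rw [h, Real.cos_add_int_mul_two_pi, Real.cos_add_pi, Real.cos_two_mul, Real.cos_sq']
  ring

lemma rpow_add_two_mul_mul_sq_rpow_neg {t : ℝ} (ht : 0 < t) (s δ ν : ℝ) :
    t ^ (δ + 2 * ν) * (s ^ 2) ^ (-ν) = t ^ δ * ((t / s) ^ 2) ^ ν := by
  rw [Real.rpow_add ht, Real.rpow_mul ht.le, Real.rpow_two, div_pow,
    Real.div_rpow (sq_nonneg t) (sq_nonneg s), Real.rpow_neg (sq_nonneg s)]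
  ring

/-- Slowly-varying property: for `ω₀ = (2k+1)π/m`, `0 < ν < 1/2` and `δ > 0`, the function
`ω ↦ (ω − ω₀)^{δ+2ν}(2 + 2cos(mω))^{−ν}` is strictly increasing on some right-hand
neighborhood `(ω₀, ω₀ + η)`, on which `2 + 2cos(mω) > 0`. -/
theorem slowly_varying_right_nbhd (m : ℕ) (hm : 1 ≤ m) (k : ℤ) (ν δ : ℝ)
    (hν0 : 0 < ν) (hν1 : ν < 1 / 2) (hδ : 0 < δ) :
    ∃ η > (0 : ℝ),
      StrictMonoOn
        (fun ω : ℝ =>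
          (ω - (2 * (k : ℝ) + 1) * Real.pi / (m : ℝ)) ^ (δ + 2 * ν) *
            (2 + 2 * Real.cos ((m : ℝ) * ω)) ^ (-ν))
        (Set.Ioo ((2 * (k : ℝ) + 1) * Real.pi / (m : ℝ))
          ((2 * (k : ℝ) + 1) * Real.pi / (m : ℝ) + η)) ∧
      ∀ ω ∈ Set.Ioo ((2 * (k : ℝ) + 1) * Real.pi / (m : ℝ))
          ((2 * (k : ℝ) + 1) * Real.pi / (m : ℝ) + η),
        0 < 2 + 2 * Real.cos ((m : ℝ) * ω) := by
  have hm0 : (0 : ℝ) < m := by exact_mod_cast hm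
  set ω₀ : ℝ := (2 * (k : ℝ) + 1) * Real.pi / (m : ℝ) with hω₀
  have hsin : ∀ ω ∈ Set.Ioo ω₀ (ω₀ + π / m),
      0 < ω - ω₀ ∧ (m : ℝ) * (ω - ω₀) / 2 ≤ π ∧ 0 < 2 * Real.sin (m * (ω - ω₀) / 2) := by
    rintro ω ⟨h₁, h₂⟩
    have ht : 0 < ω - ω₀ := sub_pos.2 h₁
    have hlt : (ω - ω₀) * m < π := (lt_div_iff₀ hm0).1 (by linarith)
    have hpi := Real.pi_pos
    refine ⟨ht, by linarith, mul_pos two_pos (Real.sin_pos_of_pos_of_lt_pi ?_ ?_)⟩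
    · positivity
    · linarith
  refine ⟨π / m, by positivity, fun x hx y hy hxy => ?_, fun ω hω => ?_⟩
  · obtain ⟨htx, -, hsx⟩ := hsin x hx
    obtain ⟨hty, hyπ, hsy⟩ := hsin y hy
    have hle : (m : ℝ) * (x - ω₀) / 2 ≤ m * (y - ω₀) / 2 := by gcongr
    have hcross := mul_sin_le_mul_sin (by positivity) hle hyπ
    have hdiv : (x - ω₀) / (2 * Real.sin (m * (x - ω₀) / 2)) ≤
        (y - ω₀) / (2 * Real.sin (m * (y - ω₀) / 2)) := by
      rw [div_le_div_iff₀ hsx hsy]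
      refine le_of_mul_le_mul_left ?_ hm0
      linarith
    simp only [two_add_two_cos_mul_eq hm0.ne' k, ← hω₀]
    rw [rpow_add_two_mul_mul_sq_rpow_neg htx, rpow_add_two_mul_mul_sq_rpow_neg hty]
    refine mul_lt_mul (Real.rpow_lt_rpow htx.le (by linarith) hδ) ?_ (by positivity) (by positivity)
    gcongr
  · rw [two_add_two_cos_mul_eq hm0.ne' k]
    exact pow_pos (hsin ω hω).2.2 2
end

section
/- Let m ≥ 1 be a natural number and ν, u real numbers. Define, for each natural number n, Π_n = ∑_{k=0}^{⌊n/m⌋} (−1)^k · (ν)_{n−(m−1)k} · (mu)^{n−mk} / (k!·(n−mk)!), where (ν)_j = ν(ν+1)⋯(ν+j−1) is the ascending Pochhammer symbol with (ν)_0 = 1. Then for every real t with m|u||t| + |t|^m < 1 (so that 1 − mut + t^m > 0), the series ∑_{n=0}^{∞} Π_n·t^n converges absolutely and its sum equals (1 − mut + t^m)^{−ν}, the real power of the positive base 1 − mut + t^m. -/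
open Real Finset

/-- The type 1 Humbert polynomial value
`Π_{n,m}^ν(u) = ∑_{k=0}^{⌊n/m⌋} (−1)^k (ν)_{n−(m−1)k} (mu)^{n−mk} / (k!(n−mk)!)`. -/
noncomputable def humbert1 (m : ℕ) (ν u : ℝ) (n : ℕ) : ℝ :=
  ∑ k ∈ Finset.range (n / m + 1),
    (-1 : ℝ) ^ k * (ascPochhammer ℝ (n - (m - 1) * k)).eval ν *
      ((m : ℝ) * u) ^ (n - m * k) / (k.factorial * (n - m * k).factorial)

/-- The binomial series of `(1 - x) ^ (-ν)`, with coefficients written as rising factorials. -/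
theorem hasSum_ascPochhammer_mul_pow (ν : ℝ) {x : ℝ} (hx : |x| < 1) :
    HasSum (fun n : ℕ => (ascPochhammer ℝ n).eval ν / n.factorial * x ^ n)
      ((1 - x) ^ (-ν)) := by
  have hmem : x ∈ Metric.eball (0 : ℝ) 1 := by
    rw [← ENNReal.ofReal_one, Metric.eball_ofReal]
    simpa using hx
  have h := (Real.one_div_one_sub_rpow_hasFPowerSeriesOnBall_zero ν).hasSum hmem
  have hcoeff (n : ℕ) : Ring.choose (ν + n - 1) n = (ascPochhammer ℝ n).eval ν / n.factorial := by
    rw [← Ring.multichoose_eq, eq_div_iff (by positivity), mul_comm, ← nsmul_eq_mul,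
      Ring.factorial_nsmul_multichoose_eq_ascPochhammer, Polynomial.ascPochhammer_smeval_eq_eval]
  have hnonneg : 0 ≤ 1 - x := by linarith [(abs_lt.mp hx).2]
  rw [zero_add, one_div, ← Real.rpow_neg hnonneg] at h
  refine h.congr_fun ?_
  simp [hcoeff, mul_comm]

/-- Expanding the powers of `a + b` in an absolutely convergent power series gives an
unconditionally convergent double series. -/
theorem hasSum_prod_choose_mul_pow {c : ℕ → ℝ} {a b s : ℝ}
    (habs : Summable fun n => |c n| * (|a| + |b|) ^ n)
    (hs : HasSum (fun n => c n * (a + b) ^ n) s) :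
    HasSum (fun p : ℕ × ℕ => c (p.1 + p.2) * (p.1 + p.2).choose p.1 * a ^ p.1 * b ^ p.2) s := by
  have expand (d x y : ℝ) (n : ℕ) :
      ∑ p ∈ antidiagonal n, d * (n.choose p.1) * x ^ p.1 * y ^ p.2 = d * (x + y) ^ n := by
    rw [(Commute.all x y).add_pow', Finset.mul_sum]
    exact Finset.sum_congr rfl fun p _ => by rw [nsmul_eq_mul]; ring
  have hfiber (f : ℕ → ℝ) (x y : ℝ) (n : ℕ) :
      HasSum (fun q : antidiagonal n =>
        f (q.1.1 + q.1.2) * (q.1.1 + q.1.2).choose q.1.1 * x ^ q.1.1 * y ^ q.1.2)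
        (f n * (x + y) ^ n) := by
    rw [← expand, ← Finset.sum_coe_sort]
    convert hasSum_fintype _ using 1
    refine Finset.sum_congr rfl fun q _ => ?_
    rw [mem_antidiagonal.mp q.2]
  rw [← HasAntidiagonal.sigmaAntidiagonalEquivProd.hasSum_iff]
  have hsum : Summable ((fun p : ℕ × ℕ =>
      c (p.1 + p.2) * (p.1 + p.2).choose p.1 * a ^ p.1 * b ^ p.2) ∘
        HasAntidiagonal.sigmaAntidiagonalEquivProd) := by
    rw [← summable_abs_iff, summable_sigma_of_nonneg fun _ => abs_nonneg _]
    refine ⟨fun n => (hasSum_fintype _).summable, ?_⟩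
    refine habs.congr fun n => ?_
    rw [← (hfiber (fun n => |c n|) |a| |b| n).tsum_eq]
    exact tsum_congr fun q => by simp [abs_mul]
  have huniq := hsum.hasSum.sigma fun n => hfiber c a b n
  exact huniq.unique hs ▸ hsum.hasSum

/-- Pairs `(k, j)`, grouped by the weighted degree `m * k + j`. -/
def sigmaRangeDivEquivProd (m : ℕ) (hm : 1 ≤ m) :
    (Σ n : ℕ, Finset.range (n / m + 1)) ≃ ℕ × ℕ where
  toFun x := (x.2, x.1 - m * x.2)
  invFun p := ⟨m * p.1 + p.2, p.1, by
    rw [Finset.mem_range, Nat.lt_succ_iff, Nat.le_div_iff_mul_le hm, mul_comm]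
    exact Nat.le_add_right _ _⟩
  left_inv := by
    rintro ⟨n, k, hk⟩
    have hle : m * k ≤ n := by
      rw [Finset.mem_range, Nat.lt_succ_iff, Nat.le_div_iff_mul_le hm] at hk
      rwa [mul_comm]
    refine Sigma.subtype_ext ?_ rfl
    exact Nat.add_sub_cancel' hle
  right_inv p := by simp

theorem humbert1_mul_pow (m : ℕ) (hm : 1 ≤ m) (ν u t : ℝ) (n : ℕ) :
    humbert1 m ν u n * t ^ n = ∑ k ∈ Finset.range (n / m + 1),
      (ascPochhammer ℝ (k + (n - m * k))).eval ν / (k + (n - m * k)).factorial *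
        (k + (n - m * k)).choose k * (-t ^ m) ^ k * (m * u * t) ^ (n - m * k) := by
  rw [humbert1, Finset.sum_mul]
  refine Finset.sum_congr rfl fun k hk => ?_
  rw [Finset.mem_range, Nat.lt_succ_iff, Nat.le_div_iff_mul_le hm, mul_comm] at hk
  obtain ⟨j, rfl⟩ := Nat.exists_eq_add_of_le hk
  have hindex : m * k + j - (m - 1) * k = k + j := by
    obtain ⟨m, rfl⟩ := Nat.exists_eq_add_of_le' hm
    rw [Nat.add_sub_cancel, add_mul, one_mul, add_assoc, Nat.add_sub_cancel_left]
  rw [hindex, Nat.add_sub_cancel_left, Nat.cast_add_choose]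
  have := Nat.factorial_ne_zero (k + j)
  rw [neg_pow (t ^ m), mul_pow _ t, pow_add, pow_mul]
  field_simp

/-- Generating function of the type 1 Humbert polynomials: for `m|u||t| + |t|^m < 1`,
the series `∑ Π_{n,m}^ν(u) tⁿ` converges absolutely to `(1 − mut + t^m)^{−ν}`. -/
theorem humbert1_generating_function (m : ℕ) (hm : 1 ≤ m) (ν u : ℝ) (t : ℝ)
    (ht : (m : ℝ) * |u| * |t| + |t| ^ m < 1) :
    (Summable fun n : ℕ => |humbert1 m ν u n * t ^ n|) ∧
      ∑' n : ℕ, humbert1 m ν u n * t ^ n =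
        (1 - (m : ℝ) * u * t + t ^ m) ^ (-ν) := by
  have hnorm : |-t ^ m| + |m * u * t| < 1 := by
    rw [abs_neg, abs_pow, abs_mul, abs_mul, Nat.abs_cast]
    linarith
  have habs := (hasSum_ascPochhammer_mul_pow ν (x := |-t ^ m| + |m * u * t|)
    (by rwa [abs_of_nonneg (by positivity)])).summable.abs
  have hdouble := hasSum_prod_choose_mul_pow (a := -t ^ m) (b := m * u * t)
    (c := fun n => (ascPochhammer ℝ n).eval ν / n.factorial)
    (habs.congr fun n => by
      rw [abs_mul, abs_of_nonneg (a := (|-t ^ m| + |m * u * t|) ^ n) (by positivity)])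
    (hasSum_ascPochhammer_mul_pow ν ((abs_add_le _ _).trans_lt hnorm))
  rw [← (sigmaRangeDivEquivProd m hm).hasSum_iff] at hdouble
  have hsum : HasSum (fun n : ℕ => humbert1 m ν u n * t ^ n)
      ((1 - (m : ℝ) * u * t + t ^ m) ^ (-ν)) := by
    convert hdouble.sigma fun n => hasSum_fintype _ using 1
    · funext n
      rw [humbert1_mul_pow m hm, ← Finset.sum_coe_sort]
      rfl
    · congr 1
      ring
  exact ⟨hsum.summable.abs, hsum.tsum_eq⟩
end

section
/- Let ν and u be real numbers, and define the Pincherle polynomial values P_n = ∑_{k=0}^{⌊n/3⌋} (−1)^k · (ν)_{n−2k} · (3u)^{n−3k} / (k!·(n−3k)!) for natural n, where (ν)_j is the ascending Pochhammer symbol. Then for every natural number n with n ≥ 2, the recurrence (n+1)·P_{n+1} − 3u(n+ν)·P_n + (n + 3ν − 2)·P_{n−2} = 0 holds. -/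
open Real Finset

/-- The Pincherle polynomial value
`P_n^ν(u) = ∑_{k=0}^{⌊n/3⌋} (−1)^k (ν)_{n−2k} (3u)^{n−3k} / (k!(n−3k)!)`. -/
noncomputable def pincherle (ν u : ℝ) (n : ℕ) : ℝ :=
  ∑ k ∈ Finset.range (n / 3 + 1),
    (-1 : ℝ) ^ k * (ascPochhammer ℝ (n - 2 * k)).eval ν *
      (3 * u) ^ (n - 3 * k) / (k.factorial * (n - 3 * k).factorial)

/-- The `k`-th summand of `pincherle ν u n`, extended by zero to `k > n / 3`. -/
noncomputable def pincherleTerm (ν u : ℝ) (n k : ℕ) : ℝ :=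
  if 3 * k ≤ n then
    (-1 : ℝ) ^ k * (ascPochhammer ℝ (n - 2 * k)).eval ν *
      (3 * u) ^ (n - 3 * k) / (k.factorial * (n - 3 * k).factorial)
  else 0

theorem pincherle_eq_sum_pincherleTerm (ν u : ℝ) {n N : ℕ} (hN : n / 3 + 1 ≤ N) :
    pincherle ν u n = ∑ k ∈ Finset.range N, pincherleTerm ν u n k := by
  rw [pincherle, ← Finset.sum_subset (Finset.range_subset_range.2 hN)]
  · refine Finset.sum_congr rfl fun k hk => ?_
    rw [Finset.mem_range] at hk
    rw [pincherleTerm, if_pos (by omega)]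
  · intro k _ hk
    rw [Finset.mem_range] at hk
    rw [pincherleTerm, if_neg (by omega)]

theorem pincherleTerm_add (ν u : ℝ) (m k : ℕ) :
    pincherleTerm ν u (3 * k + m) k =
      (-1 : ℝ) ^ k * (ascPochhammer ℝ (k + m)).eval ν * (3 * u) ^ m /
        (k.factorial * m.factorial) := by
  rw [pincherleTerm, if_pos (by omega), show 3 * k + m - 2 * k = k + m by omega,
    show 3 * k + m - 3 * k = m by omega]

theorem pincherleTerm_zero_recurrence (ν u : ℝ) (n : ℕ) :
    ((n : ℝ) + 1) * pincherleTerm ν u (n + 1) 0 -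
      3 * u * ((n : ℝ) + ν) * pincherleTerm ν u n 0 = 0 := by
  have h (m : ℕ) := pincherleTerm_add ν u m 0
  simp only [mul_zero, zero_add] at h
  rw [h, h, ascPochhammer_succ_eval, Nat.factorial_succ]
  have := Nat.factorial_ne_zero n
  push_cast
  field_simp
  ring

theorem pincherleTerm_succ_recurrence (ν u : ℝ) {n k : ℕ} (hk : 3 * k + 2 ≤ n) :
    ((n : ℝ) + 1) * pincherleTerm ν u (n + 1) (k + 1) -
      3 * u * ((n : ℝ) + ν) * pincherleTerm ν u n (k + 1) +
        ((n : ℝ) + 3 * ν - 2) * pincherleTerm ν u (n - 2) k = 0 := by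
  obtain ⟨m, rfl⟩ := Nat.exists_eq_add_of_le hk
  rw [show 3 * k + 2 + m + 1 = 3 * (k + 1) + m by ring,
    show 3 * k + 2 + m - 2 = 3 * k + m by omega, pincherleTerm_add, pincherleTerm_add,
    show k + 1 + m = k + m + 1 by ring, ascPochhammer_succ_eval, Nat.factorial_succ]
  have hk' := Nat.factorial_ne_zero k
  cases m with
  | zero =>
    rw [pincherleTerm, if_neg (by omega)]
    push_cast
    field_simp
    ring
  | succ m =>
    rw [show 3 * k + 2 + (m + 1) = 3 * (k + 1) + m by ring, pincherleTerm_add,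
      show k + 1 + m = k + (m + 1) by ring, Nat.factorial_succ k, Nat.factorial_succ m]
    have hm := Nat.factorial_ne_zero m
    push_cast
    field_simp
    ring

/-- Recurrence for the Pincherle polynomials: for `n ≥ 2`,
`(n+1)P_{n+1} − 3u(n+ν)P_n + (n + 3ν − 2)P_{n−2} = 0`. -/
theorem pincherle_recurrence (ν u : ℝ) (n : ℕ) (hn : 2 ≤ n) :
    ((n : ℝ) + 1) * pincherle ν u (n + 1) - 3 * u * ((n : ℝ) + ν) * pincherle ν u n +
      ((n : ℝ) + 3 * ν - 2) * pincherle ν u (n - 2) = 0 := by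
  rw [pincherle_eq_sum_pincherleTerm ν u (N := (n + 1) / 3 + 1) le_rfl,
    pincherle_eq_sum_pincherleTerm ν u (n := n) (N := (n + 1) / 3 + 1) (by omega),
    pincherle_eq_sum_pincherleTerm ν u (n := n - 2) (N := (n + 1) / 3) (by omega),
    Finset.sum_range_succ', Finset.sum_range_succ']
  have h : ∑ k ∈ Finset.range ((n + 1) / 3),
      (((n : ℝ) + 1) * pincherleTerm ν u (n + 1) (k + 1) -
        3 * u * ((n : ℝ) + ν) * pincherleTerm ν u n (k + 1) +
          ((n : ℝ) + 3 * ν - 2) * pincherleTerm ν u (n - 2) k) = 0 := by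
    refine Finset.sum_eq_zero fun k hk => pincherleTerm_succ_recurrence ν u ?_
    rw [Finset.mem_range] at hk
    omega
  rw [Finset.sum_add_distrib, Finset.sum_sub_distrib, ← Finset.mul_sum, ← Finset.mul_sum,
    ← Finset.mul_sum] at h
  linear_combination h + pincherleTerm_zero_recurrence ν u n
end
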